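/- (de Bruijn integral formula, even case, discrete/finite version) Let s: [a,b]² → ℝ be an integrable antisymmetric kernel (s(x,y) = -s(y,x)) and φ_1,...,φ_{2N} integrable functions. Then ∫⋯∫_{a < x_1 < ⋯ < x_{2N} < b} Pf(s(x_i,x_j))_{1≤i,j≤2N} · det(φ_i(x_j))_{1≤i,j≤2N} dx_1⋯dx_{2N} = Pf(M), where M is the skew-symmetric 2N×2N matrix with M_{i,j} = ∬_{a<x,y<b} φ_i(x) φ_j(y) s(x,y) dx dy. -/

import Mathlib

open Matrix

/-- Pfaffian of an `n × n` matrix, defined recursively by Laplace-type expansion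
along the first row (it agrees with the signed sum over perfect matchings;
it is `0` for odd `n` and `1` for `n = 0`). -/
def pf {R : Type*} [CommRing R] : (n : ℕ) → Matrix (Fin n) (Fin n) R → R
  | 0, _ => 1
  | 1, _ => 0
  | n + 2, M => ∑ j : Fin (n + 1), (-1 : R) ^ (j : ℕ) * M 0 j.succ *
      pf n ((M.submatrix Fin.succ Fin.succ).submatrix j.succAbove j.succAbove)


open MeasureTheory

section Algebra

variable {R : Type*} [CommRing R]

/-- Expansion of a signed sum over permutations of `Fin (n + 1)` according to the image of `0`. -/
theorem sum_sign_perm_fin_succ {n : ℕ} (F : (Fin (n + 1) → Fin (n + 1)) → R) :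
    ∑ σ : Equiv.Perm (Fin (n + 1)), ((Equiv.Perm.sign σ : ℤ) : R) * F σ =
      ∑ i : Fin (n + 1), (-1) ^ (i : ℕ) * ∑ τ : Equiv.Perm (Fin n),
        ((Equiv.Perm.sign τ : ℤ) : R) * F (Fin.cons i (i.succAbove ∘ τ)) := by
  let g : Fin (n + 1) × Equiv.Perm (Fin n) → Equiv.Perm (Fin (n + 1)) := fun p =>
    p.1.cycleRange.symm * Equiv.Perm.decomposeFin.symm (0, p.2)
  have hg (p) : ⇑(g p) = Fin.cons p.1 (p.1.succAbove ∘ p.2) := by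
    ext1 x
    refine Fin.cases ?_ (fun x => ?_) x <;>
      simp [g, -Equiv.Perm.decomposeFin_symm_of_refl]
  have hsign (p) : Equiv.Perm.sign (g p) = (-1) ^ (p.1 : ℕ) * Equiv.Perm.sign p.2 := by
    simp [g, Fin.sign_cycleRange]
  have hinj : Function.Injective g := by
    rintro ⟨i, τ⟩ ⟨j, ρ⟩ h
    have h' : (Fin.cons i (i.succAbove ∘ τ) : Fin (n + 1) → Fin (n + 1)) =
        Fin.cons j (j.succAbove ∘ ρ) := by
      simpa only [hg] using congrArg (fun σ : Equiv.Perm (Fin (n + 1)) => ⇑σ) h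
    obtain ⟨rfl, h2⟩ := Fin.cons_inj.1 h'
    have : τ = ρ := Equiv.ext fun x => Fin.succAbove_right_injective (congrFun h2 x)
    rw [this]
  have hbij : Function.Bijective g := by
    rw [Fintype.bijective_iff_injective_and_card]
    refine ⟨hinj, ?_⟩
    simp [Fintype.card_perm, Nat.factorial_succ]
  rw [← (Equiv.ofBijective g hbij).sum_comp, Fintype.sum_prod_type]
  refine Finset.sum_congr rfl fun i _ => ?_
  rw [Finset.mul_sum]
  refine Finset.sum_congr rfl fun τ _ => ?_
  simp only [Equiv.ofBijective_apply, hsign, hg]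
  push_cast
  ring

/-- The first element of the `k`-th consecutive pair in `Fin (2 * N)`. -/
def pairFst {N : ℕ} (k : Fin N) : Fin (2 * N) := ⟨2 * k, by omega⟩

/-- The second element of the `k`-th consecutive pair in `Fin (2 * N)`. -/
def pairSnd {N : ℕ} (k : Fin N) : Fin (2 * N) := ⟨2 * k + 1, by omega⟩

theorem pairFst_injective {N : ℕ} : Function.Injective (pairFst (N := N)) := fun i j h => by
  simp only [pairFst, Fin.mk.injEq] at h
  omega

theorem pairSnd_injective {N : ℕ} : Function.Injective (pairSnd (N := N)) := fun i j h => by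
  simp only [pairSnd, Fin.mk.injEq] at h
  omega

theorem pairFst_ne_pairSnd {N : ℕ} (i j : Fin N) : pairFst i ≠ pairSnd j := fun h => by
  simp only [pairFst, pairSnd, Fin.mk.injEq] at h
  omega

/-- The decomposition of `Fin (2 * N)` into first and second elements of consecutive pairs. -/
noncomputable def pairEquiv (N : ℕ) : Fin N ⊕ Fin N ≃ Fin (2 * N) :=
  Equiv.ofBijective (Sum.elim pairFst pairSnd) <| by
    rw [Fintype.bijective_iff_injective_and_card]
    refine ⟨pairFst_injective.sumElim pairSnd_injective pairFst_ne_pairSnd, ?_⟩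
    simp
    omega

@[simp] theorem pairEquiv_inl {N : ℕ} (k : Fin N) : pairEquiv N (.inl k) = pairFst k := rfl

@[simp] theorem pairEquiv_inr {N : ℕ} (k : Fin N) : pairEquiv N (.inr k) = pairSnd k := rfl

theorem prod_eq_prod_pair {N : ℕ} (f : Fin (2 * N) → R) :
    ∏ i, f i = ∏ k : Fin N, f (pairFst k) * f (pairSnd k) := by
  rw [← (pairEquiv N).prod_comp, Fintype.prod_sum_type, ← Finset.prod_mul_distrib]
  simp

/-- The product of the entries of `M` at consecutive pairs of indices of the tuple `f`. -/
def pairProd {ι : Type*} {N : ℕ} (M : Matrix ι ι R) (f : Fin (2 * N) → ι) : R :=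
  ∏ k : Fin N, M (f (pairFst k)) (f (pairSnd k))

/-- The signed sum over all permutations which is `2 ^ N * N!` times the Pfaffian. -/
def pfSum {N : ℕ} (M : Matrix (Fin (2 * N)) (Fin (2 * N)) R) : R :=
  ∑ σ : Equiv.Perm (Fin (2 * N)), ((Equiv.Perm.sign σ : ℤ) : R) * pairProd M σ

theorem pairProd_comp_swap_pairs {ι : Type*} {N : ℕ} (M : Matrix ι ι R) (f : Fin (2 * N) → ι)
    (k l : Fin N) :
    pairProd M (f ∘ (Equiv.swap (pairFst k) (pairFst l) * Equiv.swap (pairSnd k) (pairSnd l) :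
      Equiv.Perm (Fin (2 * N)))) = pairProd M f := by
  unfold pairProd
  rw [← Equiv.prod_comp (Equiv.swap k l) fun i => M (f (pairFst i)) (f (pairSnd i))]
  refine Finset.prod_congr rfl fun i _ => ?_
  have h1 : Equiv.swap (pairSnd k) (pairSnd l) (pairFst i) = pairFst i :=
    Equiv.swap_apply_of_ne_of_ne (pairFst_ne_pairSnd _ _) (pairFst_ne_pairSnd _ _)
  have h2 (j : Fin N) : Equiv.swap (pairFst k) (pairFst l) (pairSnd j) = pairSnd j :=
    Equiv.swap_apply_of_ne_of_ne (pairFst_ne_pairSnd _ _).symm (pairFst_ne_pairSnd _ _).symm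
  have h3 : Equiv.swap (pairFst k) (pairFst l) (pairFst i) = pairFst (Equiv.swap k l i) :=
    (pairFst_injective.map_swap _ _ _).symm
  have h4 : Equiv.swap (pairSnd k) (pairSnd l) (pairSnd i) = pairSnd (Equiv.swap k l i) :=
    (pairSnd_injective.map_swap _ _ _).symm
  simp [Function.comp, h1, h2, h3, h4]

theorem pairProd_comp_swap_within {ι : Type*} {N : ℕ} {M : Matrix ι ι R}
    (hM : ∀ i j, M i j = -M j i) (f : Fin (2 * N) → ι) (k : Fin N) :
    pairProd M (f ∘ Equiv.swap (pairFst k) (pairSnd k)) = -pairProd M f := by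
  unfold pairProd
  have h (i : Fin N) : M ((f ∘ Equiv.swap (pairFst k) (pairSnd k)) (pairFst i))
      ((f ∘ Equiv.swap (pairFst k) (pairSnd k)) (pairSnd i)) =
      (if i = k then -1 else 1) * M (f (pairFst i)) (f (pairSnd i)) := by
    by_cases hik : i = k
    · subst hik
      simp [hM (f (pairSnd i))]
    · have h1 : Equiv.swap (pairFst k) (pairSnd k) (pairFst i) = pairFst i :=
        Equiv.swap_apply_of_ne_of_ne (pairFst_injective.ne hik) (pairFst_ne_pairSnd _ _)
      have h2 : Equiv.swap (pairFst k) (pairSnd k) (pairSnd i) = pairSnd i :=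
        Equiv.swap_apply_of_ne_of_ne (pairFst_ne_pairSnd _ _).symm (pairSnd_injective.ne hik)
      simp [hik, h1, h2]
  simp_rw [h, Finset.prod_mul_distrib]
  simp

/-- In the sum defining `pfSum`, the index `0` may be assumed to stay in position `0`. -/
theorem pfSum_eq_sum_ite {N : ℕ} {M : Matrix (Fin (2 * (N + 1))) (Fin (2 * (N + 1))) R}
    (hM : ∀ i j, M i j = -M j i) :
    pfSum M = (2 * (N + 1) : ℕ) * ∑ σ : Equiv.Perm (Fin (2 * (N + 1))),
      ((Equiv.Perm.sign σ : ℤ) : R) *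
        (if σ (pairFst 0) = 0 then pairProd M σ else 0) := by
  let Q : Fin (2 * (N + 1)) → R := fun m => ∑ σ : Equiv.Perm (Fin (2 * (N + 1))),
      ((Equiv.Perm.sign σ : ℤ) : R) * (if σ m = 0 then pairProd M σ else 0)
  have key : ∀ (π : Equiv.Perm (Fin (2 * (N + 1)))) (m : Fin (2 * (N + 1))),
      (∀ σ : Equiv.Perm (Fin (2 * (N + 1))),
        pairProd M (σ ∘ π) = ((Equiv.Perm.sign π : ℤ) : R) * pairProd M σ) → Q (π m) = Q m := by
    intro π m h
    have hsq : ((Equiv.Perm.sign π : ℤ) : R) * ((Equiv.Perm.sign π : ℤ) : R) = 1 := by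
      rw [← Int.cast_mul, ← Units.val_mul, Int.units_mul_self]
      simp
    change Q (π m) = ∑ σ : Equiv.Perm (Fin (2 * (N + 1))), _
    rw [← Equiv.sum_comp (Equiv.mulRight π)]
    refine Finset.sum_congr rfl fun σ _ => ?_
    simp only [Equiv.coe_mulRight, Equiv.Perm.sign_mul, Equiv.Perm.coe_mul, h,
      Function.comp_apply]
    split_ifs
    · push_cast
      linear_combination (-(((Equiv.Perm.sign σ : ℤ) : R) * pairProd M σ)) * hsq
    · simp
  have hfst (k : Fin (N + 1)) : Q (pairFst k) = Q (pairFst 0) := by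
    have := key (Equiv.swap (pairFst 0) (pairFst k) * Equiv.swap (pairSnd 0) (pairSnd k))
      (pairFst 0) (fun σ => by
        rw [pairProd_comp_swap_pairs]
        rcases eq_or_ne 0 k with rfl | hk
        · simp
        · simp [Equiv.Perm.sign_swap (pairFst_injective.ne hk),
            Equiv.Perm.sign_swap (pairSnd_injective.ne hk)])
    rwa [Equiv.Perm.mul_apply, Equiv.swap_apply_of_ne_of_ne (pairFst_ne_pairSnd _ _)
      (pairFst_ne_pairSnd _ _), Equiv.swap_apply_left] at this
  have hsnd (k : Fin (N + 1)) : Q (pairSnd k) = Q (pairFst k) := by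
    have := key (Equiv.swap (pairFst k) (pairSnd k)) (pairFst k) (fun σ => by
      rw [pairProd_comp_swap_within hM, Equiv.Perm.sign_swap (pairFst_ne_pairSnd _ _)]
      simp)
    rwa [Equiv.swap_apply_left] at this
  have hall (m) : Q m = Q (pairFst 0) := by
    obtain ⟨k | k, rfl⟩ := (pairEquiv (N + 1)).surjective m
    · exact hfst k
    · exact (hsnd k).trans (hfst k)
  have hsum : pfSum M = ∑ m, Q m := by
    simp only [Q, pfSum]
    rw [Finset.sum_comm]
    refine Finset.sum_congr rfl fun σ _ => ?_
    rw [← Finset.mul_sum, Equiv.sum_comp σ (fun m => if m = 0 then pairProd M σ else 0)]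
    simp
  rw [hsum, Finset.sum_congr rfl fun m _ => hall m]
  simp [Q]

theorem pfSum_eq_mul_pf : ∀ {N : ℕ} {M : Matrix (Fin (2 * N)) (Fin (2 * N)) R},
    (∀ i j, M i j = -M j i) → pfSum M = (2 ^ N * N.factorial : ℕ) * pf (2 * N) M
  | 0, M, _ => by
    simp [pfSum, pf, pairProd]
  | N + 1, M, hM => by
    rw [pfSum_eq_sum_ite hM]
    have h1 := sum_sign_perm_fin_succ (n := 2 * N + 1)
      (fun f => if f 0 = 0 then pairProd (N := N + 1) M f else 0)
    have h2 := sum_sign_perm_fin_succ (n := 2 * N)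
      (fun f => pairProd (N := N + 1) M (Fin.cons 0 (Fin.succ ∘ f)))
    have h3 (j : Fin (2 * N + 1)) (τ : Equiv.Perm (Fin (2 * N))) :
        pairProd (N := N + 1) M (Fin.cons 0 (Fin.succ ∘ Fin.cons j (j.succAbove ∘ τ))) =
          M 0 j.succ * pairProd
            ((M.submatrix Fin.succ Fin.succ).submatrix j.succAbove j.succAbove) τ :=
      Fin.prod_univ_succ _
    refine (congrArg _ (h1.trans (?_ : _ = ∑ j : Fin (2 * N + 1), (-1 : R) ^ (j : ℕ) *
      (M 0 j.succ * pfSum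
        ((M.submatrix Fin.succ Fin.succ).submatrix j.succAbove j.succAbove))))).trans ?_
    · rw [Fin.sum_univ_succ]
      simp only [Fin.cons_zero, Fin.succ_ne_zero, if_false, mul_zero, Finset.sum_const_zero,
        add_zero, if_true, Fin.val_zero, pow_zero, one_mul]
      refine Eq.trans ?_ (h2.trans ?_)
      · rfl
      · simp only [h3, pfSum, Finset.mul_sum]
        refine Finset.sum_congr rfl fun j _ => Finset.sum_congr rfl fun τ _ => ?_
        ring
    · have ih (j : Fin (2 * N + 1)) := pfSum_eq_mul_pf (N := N)
        (M := (M.submatrix Fin.succ Fin.succ).submatrix j.succAbove j.succAbove)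
        (fun _ _ => hM _ _)
      simp only [ih]
      change _ = _ * pf (2 * N + 2) M
      rw [pf, Finset.mul_sum, Finset.mul_sum]
      refine Finset.sum_congr rfl fun j _ => ?_
      push_cast [Nat.factorial_succ]
      ring

/-- The product of the permutation-summed Pfaffian and a determinant is the symmetrization of a
single summand. -/
theorem pfSum_mul_det {α : Type*} {N : ℕ} (s : α → α → R) (φ : Fin (2 * N) → α → R)
    (u : Fin (2 * N) → α) :
    pfSum (Matrix.of fun i j => s (u i) (u j)) * (Matrix.of fun i j => φ i (u j)).det =
      ∑ σ : Equiv.Perm (Fin (2 * N)), ∑ τ : Equiv.Perm (Fin (2 * N)),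
        ((Equiv.Perm.sign τ : ℤ) : R) *
          ∏ k : Fin N, (φ (τ (pairFst k)) (u (σ (pairFst k))) *
            φ (τ (pairSnd k)) (u (σ (pairSnd k))) *
              s (u (σ (pairFst k))) (u (σ (pairSnd k)))) := by
  rw [pfSum, Finset.sum_mul]
  refine Finset.sum_congr rfl fun σ _ => ?_
  have h := Matrix.det_permute' σ (Matrix.of fun i j => φ i (u j))
  rw [mul_right_comm, ← h, Matrix.det_apply', Finset.sum_mul]
  refine Finset.sum_congr rfl fun τ _ => ?_
  rw [mul_assoc, prod_eq_prod_pair, pairProd, ← Finset.prod_mul_distrib]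
  rfl

end Algebra

section Integration

/-- Grouping the coordinates of `Fin (2 * N) → α` into consecutive pairs. -/
noncomputable def piPairEquiv (α : Type*) [MeasurableSpace α] (N : ℕ) :
    (Fin (2 * N) → α) ≃ᵐ (Fin N → α × α) :=
  ((MeasurableEquiv.piCongrLeft (fun _ => α) (pairEquiv N)).symm.trans
    (MeasurableEquiv.sumPiEquivProdPi fun _ => α)).trans
      (MeasurableEquiv.arrowProdEquivProdArrow α α (Fin N)).symm

theorem piPairEquiv_apply {α : Type*} [MeasurableSpace α] {N : ℕ} (u : Fin (2 * N) → α)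
    (k : Fin N) : piPairEquiv α N u k = (u (pairFst k), u (pairSnd k)) := rfl

variable {α : Type*} [MeasurableSpace α] (μ : Measure α) [SigmaFinite μ]

theorem measurePreserving_piPairEquiv (N : ℕ) :
    MeasurePreserving (piPairEquiv α N) (Measure.pi fun _ => μ)
      (Measure.pi fun _ => μ.prod μ) :=
  ((measurePreserving_arrowProdEquivProdArrow α α (Fin N) (fun _ => μ) (fun _ => μ)).symm _).comp
    ((measurePreserving_sumPiEquivProdPi fun _ => μ).comp
      ((measurePreserving_piCongrLeft (fun _ => μ) (pairEquiv N)).symm _))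

theorem integrable_prod_pair {N : ℕ} {K : Fin N → α × α → ℝ}
    (hK : ∀ k, Integrable (K k) (μ.prod μ)) :
    Integrable (fun u : Fin (2 * N) → α => ∏ k, K k (u (pairFst k), u (pairSnd k)))
      (Measure.pi fun _ => μ) :=
  (measurePreserving_piPairEquiv μ N).integrable_comp_of_integrable
    (Integrable.fintype_prod (μ := fun _ : Fin N => μ.prod μ) hK)

theorem integral_prod_pair {N : ℕ} (K : Fin N → α × α → ℝ) :
    ∫ u : Fin (2 * N) → α, ∏ k, K k (u (pairFst k), u (pairSnd k)) ∂(Measure.pi fun _ => μ) =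
      ∏ k, ∫ p, K k p ∂(μ.prod μ) := by
  rw [← integral_fintype_prod_eq_prod (μ := fun _ : Fin N => μ.prod μ) K,
    ← (measurePreserving_piPairEquiv μ N).integral_comp']
  rfl

theorem measurePreserving_comp_perm {n : ℕ} (σ : Equiv.Perm (Fin n)) :
    MeasurePreserving (fun u : Fin n → α => u ∘ σ) (Measure.pi fun _ => μ)
      (Measure.pi fun _ => μ) :=
  (measurePreserving_piCongrLeft (fun _ => μ) σ).symm _

theorem integral_comp_perm {n : ℕ} (σ : Equiv.Perm (Fin n)) (H : (Fin n → α) → ℝ) :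
    ∫ u, H (u ∘ σ) ∂(Measure.pi fun _ => μ) = ∫ u, H u ∂(Measure.pi fun _ => μ) :=
  ((measurePreserving_piCongrLeft (fun _ => μ) σ).symm _).integral_comp' H

theorem existsUnique_strictMono_comp_perm {β : Type*} [LinearOrder β] {n : ℕ} {u : Fin n → β}
    (hu : Function.Injective u) : ∃! σ : Equiv.Perm (Fin n), StrictMono (u ∘ σ) := by
  refine ⟨Tuple.sort u, (Tuple.monotone_sort u).strictMono_of_injective
    (hu.comp (Tuple.sort u).injective), fun σ hσ => ?_⟩
  exact Equiv.ext fun x => hu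
    (congrFun (Tuple.unique_monotone hσ.monotone (Tuple.monotone_sort u)) x)

theorem measurableSet_strictMono (n : ℕ) : MeasurableSet {u : Fin n → ℝ | StrictMono u} := by
  simp only [StrictMono, Set.ofPred_forall]
  refine .iInter fun i => .iInter fun j => .iInter fun _ => ?_
  exact measurableSet_lt (measurable_pi_apply i) (measurable_pi_apply j)

/-- An integral over a cube is the integral of the symmetrization over the ordered simplex. -/
theorem integral_eq_setIntegral_sum_perm {n : ℕ} (μ : Measure ℝ) [SigmaFinite μ]
    {H : (Fin n → ℝ) → ℝ} (hH : Integrable H (Measure.pi fun _ => μ))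
    (hinj : ∀ᵐ u ∂(Measure.pi fun _ : Fin n => μ), Function.Injective u) :
    ∫ u, H u ∂(Measure.pi fun _ => μ) =
      ∫ u in {u : Fin n → ℝ | StrictMono u}, ∑ σ : Equiv.Perm (Fin n), H (u ∘ σ)
        ∂(Measure.pi fun _ => μ) := by
  have hS := measurableSet_strictMono n
  have hHσ (σ : Equiv.Perm (Fin n)) :
      Integrable (fun u => H (u ∘ σ)) (Measure.pi fun _ : Fin n => μ) :=
    (measurePreserving_comp_perm μ σ).integrable_comp_of_integrable hH
  have hpre (σ : Equiv.Perm (Fin n)) :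
      MeasurableSet {u : Fin n → ℝ | StrictMono (u ∘ ⇑σ)} :=
    (measurePreserving_comp_perm μ σ).measurable hS
  rw [integral_finsetSum _ fun σ _ => (hHσ σ).integrableOn]
  have hterm (σ : Equiv.Perm (Fin n)) :
      ∫ u in {u : Fin n → ℝ | StrictMono u}, H (u ∘ σ) ∂(Measure.pi fun _ => μ) =
        ∫ u, {u : Fin n → ℝ | StrictMono (u ∘ ⇑σ⁻¹)}.indicator H u
          ∂(Measure.pi fun _ => μ) := by
    rw [← integral_indicator hS, ← integral_comp_perm μ σ (Set.indicator _ H)]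
    congr 1 with u
    have : (u ∘ ⇑σ) ∘ ⇑σ⁻¹ = u := by ext; simp
    simp only [Set.indicator_apply, Set.mem_ofPred_eq, this]
  simp_rw [hterm]
  rw [← integral_finsetSum _ fun σ _ => hH.indicator (hpre σ⁻¹)]
  refine integral_congr_ae ?_
  filter_upwards [hinj] with u hu
  obtain ⟨σ, hσ, huniq⟩ := existsUnique_strictMono_comp_perm hu
  rw [Finset.sum_eq_single σ⁻¹]
  · simp [hσ]
  · intro τ _ hτ
    refine Set.indicator_of_notMem (fun h => hτ ?_) _
    rw [← huniq _ h, inv_inv]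
  · simp

theorem ae_injective_pi (n : ℕ) :
    ∀ᵐ u ∂(volume : Measure (Fin n → ℝ)), Function.Injective u := by
  have h (i j : Fin n) (hij : i ≠ j) : ∀ᵐ u ∂(volume : Measure (Fin n → ℝ)), u i ≠ u j := by
    rw [ae_iff]
    let p : Submodule ℝ (Fin n → ℝ) :=
      LinearMap.ker ((LinearMap.proj i : (Fin n → ℝ) →ₗ[ℝ] ℝ) - LinearMap.proj j)
    have hp : {u : Fin n → ℝ | ¬u i ≠ u j} = p := by
      ext u
      simp [p, sub_eq_zero]
    rw [hp]
    refine Measure.addHaar_submodule _ _ fun htop => ?_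
    have : Pi.single i (1 : ℝ) ∈ p := htop ▸ Submodule.mem_top
    simp [p, hij] at this
  have := ae_all_iff.2 fun i => ae_all_iff.2 fun j => ae_all_iff.2 fun hij => h i j hij
  filter_upwards [this] with u hu i j hij
  by_contra hne
  exact hu i j hne hij

end Integration

/-- de Bruijn's formula with respect to a measure whose product has almost surely distinct
coordinates, with the permutation-summed Pfaffian. -/
theorem setIntegral_pfSum_mul_det {N : ℕ} (μ : Measure ℝ) [SigmaFinite μ] (s : ℝ → ℝ → ℝ)
    (φ : Fin (2 * N) → ℝ → ℝ)
    (hinj : ∀ᵐ u ∂(Measure.pi fun _ : Fin (2 * N) => μ), Function.Injective u)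
    (hint : ∀ i j, Integrable (fun p : ℝ × ℝ => φ i p.1 * φ j p.2 * s p.1 p.2) (μ.prod μ)) :
    ∫ u in {u : Fin (2 * N) → ℝ | StrictMono u},
        pfSum (Matrix.of fun i j => s (u i) (u j)) * (Matrix.of fun i j => φ i (u j)).det
          ∂(Measure.pi fun _ => μ) =
      pfSum (Matrix.of fun i j => ∫ p, φ i p.1 * φ j p.2 * s p.1 p.2 ∂(μ.prod μ)) := by
  let K (τ : Equiv.Perm (Fin (2 * N))) (k : Fin N) (p : ℝ × ℝ) : ℝ :=
    φ (τ (pairFst k)) p.1 * φ (τ (pairSnd k)) p.2 * s p.1 p.2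
  have hK (τ) : Integrable (fun u : Fin (2 * N) → ℝ =>
      ((Equiv.Perm.sign τ : ℤ) : ℝ) * ∏ k, K τ k (u (pairFst k), u (pairSnd k)))
      (Measure.pi fun _ => μ) :=
    (integrable_prod_pair μ fun k => hint _ _).const_mul _
  simp_rw [pfSum_mul_det]
  refine (integral_eq_setIntegral_sum_perm μ
    (integrable_finsetSum Finset.univ fun τ _ => hK τ) hinj).symm.trans ?_
  rw [integral_finsetSum _ fun τ _ => hK τ]
  refine Finset.sum_congr rfl fun τ _ => ?_
  rw [integral_const_mul, integral_prod_pair]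
  rfl

/-- de Bruijn integral formula, even case: for an antisymmetric
kernel `s` and functions `φ₁,…,φ_{2N}`,
`∫_{a<x₁<⋯<x_{2N}<b} Pf(s(xᵢ,xⱼ)) det(φᵢ(xⱼ)) dx = Pf(M)` with
`M i j = ∬_{a<x,y<b} φᵢ(x) φⱼ(y) s(x,y) dx dy`. -/
theorem deBruijn_even (N : ℕ) (a b : ℝ) (s : ℝ → ℝ → ℝ) (φ : Fin (2 * N) → ℝ → ℝ)
    (hs : ∀ x y, s x y = - s y x)
    (hint : IntegrableOn
      (fun u : Fin (2 * N) → ℝ =>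
        pf (2 * N) (Matrix.of fun i j => s (u i) (u j)) *
          (Matrix.of fun i j => φ i (u j)).det)
      {u : Fin (2 * N) → ℝ | (∀ i j : Fin (2 * N), i < j → u i < u j) ∧
        ∀ i, u i ∈ Set.Ioo a b})
    (hint2 : ∀ i j : Fin (2 * N), IntegrableOn
      (fun p : ℝ × ℝ => φ i p.1 * φ j p.2 * s p.1 p.2)
      (Set.Ioo a b ×ˢ Set.Ioo a b)) :
    (∫ u in {u : Fin (2 * N) → ℝ | (∀ i j : Fin (2 * N), i < j → u i < u j) ∧
        ∀ i, u i ∈ Set.Ioo a b},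
      pf (2 * N) (Matrix.of fun i j => s (u i) (u j)) *
        (Matrix.of fun i j => φ i (u j)).det)
      = pf (2 * N) (Matrix.of fun i j =>
          ∫ p in Set.Ioo a b ×ˢ Set.Ioo a b, φ i p.1 * φ j p.2 * s p.1 p.2) := by
  set μ : Measure ℝ := volume.restrict (Set.Ioo a b)
  have hprod : (volume : Measure (ℝ × ℝ)).restrict (Set.Ioo a b ×ˢ Set.Ioo a b) = μ.prod μ :=
    (Measure.prod_restrict _ _).symm
  have hpi : (Measure.pi fun _ : Fin (2 * N) => μ) =
      volume.restrict (Set.univ.pi fun _ => Set.Ioo a b) :=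
    (Measure.restrict_pi_pi _ _).symm
  have hset : (volume : Measure (Fin (2 * N) → ℝ)).restrict
      {u | (∀ i j : Fin (2 * N), i < j → u i < u j) ∧ ∀ i, u i ∈ Set.Ioo a b} =
      (Measure.pi fun _ : Fin (2 * N) => μ).restrict {u | StrictMono u} := by
    rw [hpi, Measure.restrict_restrict (measurableSet_strictMono _)]
    congr 1
    ext u
    simp [StrictMono]
  have hinj : ∀ᵐ u ∂(Measure.pi fun _ : Fin (2 * N) => μ), Function.Injective u := by
    rw [hpi]
    exact ae_restrict_of_ae (ae_injective_pi _)
  have hc : ((2 ^ N * N.factorial : ℕ) : ℝ) ≠ 0 := by positivity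
  simp only [IntegrableOn, hprod] at hint2
  rw [hset, hprod]
  refine mul_left_cancel₀ hc ?_
  rw [← integral_const_mul, ← pfSum_eq_mul_pf, ← setIntegral_pfSum_mul_det μ s φ hinj hint2]
  · refine integral_congr_ae (.of_forall fun u => ?_)
    simp only
    rw [← mul_assoc, ← pfSum_eq_mul_pf (M := Matrix.of fun i j => s (u i) (u j))
      fun i j => hs (u i) (u j)]
  · intro i j
    simp only [Matrix.of_apply]
    rw [← integral_neg, ← integral_prod_swap]
    congr 1 with p
    rw [Prod.fst_swap, Prod.snd_swap, hs]
    ring
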